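/- Over ℂ, if p' ∈ A'⊗B'⊗C' and p'' ∈ A''⊗B''⊗C'' are tensors with R(p') ≤ 7 and R(p'') ≤ 7, then R(p'⊕p'') = R(p') + R(p''). -/

import Mathlib

open TensorProduct

/-- Tensor rank of `p ∈ A ⊗ B ⊗ C`: minimal number of simple tensors summing to `p`. -/
noncomputable def tRank (k : Type*) [Field k] {A B C : Type*} [AddCommGroup A] [Module k A]
    [AddCommGroup B] [Module k B] [AddCommGroup C] [Module k C]
    (p : A ⊗[k] (B ⊗[k] C)) : ℕ :=
  sInf {r | ∃ a : Fin r → A, ∃ b : Fin r → B, ∃ c : Fin r → C,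
    p = ∑ i, a i ⊗ₜ[k] (b i ⊗ₜ[k] c i)}

/-- The direct sum tensor `p' ⊕ p''`. -/
noncomputable def dsTensor {k : Type*} [Field k] {A' A'' B' B'' C' C'' : Type*}
    [AddCommGroup A'] [Module k A'] [AddCommGroup A''] [Module k A'']
    [AddCommGroup B'] [Module k B'] [AddCommGroup B''] [Module k B'']
    [AddCommGroup C'] [Module k C'] [AddCommGroup C''] [Module k C'']
    (p' : A' ⊗[k] (B' ⊗[k] C')) (p'' : A'' ⊗[k] (B'' ⊗[k] C'')) :
    (A' × A'') ⊗[k] ((B' × B'') ⊗[k] (C' × C'')) :=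
  TensorProduct.map (LinearMap.inl k A' A'')
    (TensorProduct.map (LinearMap.inl k B' B'') (LinearMap.inl k C' C'')) p'
  + TensorProduct.map (LinearMap.inr k A' A'')
    (TensorProduct.map (LinearMap.inr k B' B'') (LinearMap.inr k C' C'')) p''

section TensorRank

variable {k : Type*} [Field k] {A B C D E F : Type*}
  [AddCommGroup A] [Module k A] [AddCommGroup B] [Module k B] [AddCommGroup C] [Module k C]
  [AddCommGroup D] [Module k D] [AddCommGroup E] [Module k E] [AddCommGroup F] [Module k F]

lemma tRank_sum_le_card {I : Type*} (s : Finset I) (a : I → A) (b : I → B) (c : I → C) :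
    tRank k (∑ i ∈ s, a i ⊗ₜ[k] (b i ⊗ₜ[k] c i)) ≤ s.card := by
  refine Nat.sInf_le ⟨fun j => a (s.equivFin.symm j), fun j => b (s.equivFin.symm j),
    fun j => c (s.equivFin.symm j), ?_⟩
  rw [s.equivFin.symm.sum_comp (fun i : s => a i ⊗ₜ[k] (b i ⊗ₜ[k] c i))]
  exact (Finset.sum_coe_sort s fun i => a i ⊗ₜ[k] (b i ⊗ₜ[k] c i)).symm

lemma exists_sum_fin (p : A ⊗[k] (B ⊗[k] C)) :
    ∃ (r : ℕ) (a : Fin r → A) (b : Fin r → B) (c : Fin r → C),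
      p = ∑ i, a i ⊗ₜ[k] (b i ⊗ₜ[k] c i) := by
  have add : ∀ p q : A ⊗[k] (B ⊗[k] C),
      (∃ (r : ℕ) (a : Fin r → A) (b : Fin r → B) (c : Fin r → C),
        p = ∑ i, a i ⊗ₜ[k] (b i ⊗ₜ[k] c i)) →
      (∃ (r : ℕ) (a : Fin r → A) (b : Fin r → B) (c : Fin r → C),
        q = ∑ i, a i ⊗ₜ[k] (b i ⊗ₜ[k] c i)) →
      ∃ (r : ℕ) (a : Fin r → A) (b : Fin r → B) (c : Fin r → C),
        p + q = ∑ i, a i ⊗ₜ[k] (b i ⊗ₜ[k] c i) := by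
    rintro _ _ ⟨r, a, b, c, rfl⟩ ⟨s, a', b', c', rfl⟩
    exact ⟨r + s, Fin.append a a', Fin.append b b', Fin.append c c', by
      simp [Fin.sum_univ_add]⟩
  induction p using TensorProduct.induction_on with
  | zero => exact ⟨0, Fin.elim0, Fin.elim0, Fin.elim0, by simp⟩
  | add p q hp hq => exact add p q hp hq
  | tmul x y =>
    induction y using TensorProduct.induction_on with
    | zero => exact ⟨0, Fin.elim0, Fin.elim0, Fin.elim0, by simp⟩
    | add p q hp hq => rw [tmul_add]; exact add _ _ hp hq
    | tmul y z => exact ⟨1, fun _ => x, fun _ => y, fun _ => z, by simp⟩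

lemma exists_sum_tRank (p : A ⊗[k] (B ⊗[k] C)) :
    ∃ (a : Fin (tRank k p) → A) (b : Fin (tRank k p) → B) (c : Fin (tRank k p) → C),
      p = ∑ i, a i ⊗ₜ[k] (b i ⊗ₜ[k] c i) :=
  Nat.sInf_mem (s := {r | ∃ a : Fin r → A, ∃ b : Fin r → B, ∃ c : Fin r → C,
    p = ∑ i, a i ⊗ₜ[k] (b i ⊗ₜ[k] c i)}) (exists_sum_fin p)

lemma tRank_add_le (p q : A ⊗[k] (B ⊗[k] C)) :
    tRank k (p + q) ≤ tRank k p + tRank k q := by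
  obtain ⟨a, b, c, h⟩ := exists_sum_tRank p
  obtain ⟨a', b', c', hq⟩ := exists_sum_tRank q
  refine Nat.sInf_le ⟨Fin.append a a', Fin.append b b', Fin.append c c', ?_⟩
  simp [Fin.sum_univ_add, ← h, ← hq]

/-- A linear map sending simple tensors to simple tensors does not increase the rank. -/
lemma tRank_map_le_of_simple (f : A ⊗[k] (B ⊗[k] C) →ₗ[k] D ⊗[k] (E ⊗[k] F))
    (hf : ∀ a b c, ∃ d e g, f (a ⊗ₜ (b ⊗ₜ c)) = d ⊗ₜ (e ⊗ₜ g)) (p : A ⊗[k] (B ⊗[k] C)) :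
    tRank k (f p) ≤ tRank k p := by
  obtain ⟨a, b, c, h⟩ := exists_sum_tRank p
  choose d e g hd using hf
  refine Nat.sInf_le ⟨fun i => d (a i) (b i) (c i), fun i => e (a i) (b i) (c i),
    fun i => g (a i) (b i) (c i), ?_⟩
  conv_lhs => rw [h]
  simp [hd]

lemma tRank_map_le (f : A →ₗ[k] D) (g : B →ₗ[k] E) (h : C →ₗ[k] F) (p : A ⊗[k] (B ⊗[k] C)) :
    tRank k (TensorProduct.map f (TensorProduct.map g h) p) ≤ tRank k p :=
  tRank_map_le_of_simple _ (fun a b c => ⟨f a, g b, h c, by simp⟩) p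

variable {I : Type*} (s : Finset I) (a : I → A) (b : I → B) (c : I → C)

lemma map_comm_sum :
    TensorProduct.map LinearMap.id (TensorProduct.comm k B C).toLinearMap
      (∑ i ∈ s, a i ⊗ₜ[k] (b i ⊗ₜ[k] c i)) = ∑ i ∈ s, a i ⊗ₜ[k] (c i ⊗ₜ[k] b i) := by
  simp

lemma leftComm_sum :
    TensorProduct.leftComm k A B C (∑ i ∈ s, a i ⊗ₜ[k] (b i ⊗ₜ[k] c i)) =
      ∑ i ∈ s, b i ⊗ₜ[k] (a i ⊗ₜ[k] c i) := by
  simp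

lemma tRank_sum_comm :
    tRank k (∑ i ∈ s, a i ⊗ₜ[k] (c i ⊗ₜ[k] b i)) =
      tRank k (∑ i ∈ s, a i ⊗ₜ[k] (b i ⊗ₜ[k] c i)) := by
  apply le_antisymm
  · rw [← map_comm_sum]
    exact tRank_map_le_of_simple _ (fun a b c => ⟨a, c, b, by simp⟩) _
  · rw [← map_comm_sum s a c b]
    exact tRank_map_le_of_simple _ (fun a b c => ⟨a, c, b, by simp⟩) _

lemma tRank_sum_leftComm :
    tRank k (∑ i ∈ s, b i ⊗ₜ[k] (a i ⊗ₜ[k] c i)) =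
      tRank k (∑ i ∈ s, a i ⊗ₜ[k] (b i ⊗ₜ[k] c i)) := by
  apply le_antisymm
  · rw [← leftComm_sum]
    exact tRank_map_le_of_simple (TensorProduct.leftComm k A B C).toLinearMap
      (fun a b c => ⟨b, a, c, by simp⟩) _
  · rw [← leftComm_sum s b a c]
    exact tRank_map_le_of_simple (TensorProduct.leftComm k B A C).toLinearMap
      (fun a b c => ⟨b, a, c, by simp⟩) _

lemma sum_comm_eq_zero (h : ∑ i ∈ s, a i ⊗ₜ[k] (b i ⊗ₜ[k] c i) = 0) :
    ∑ i ∈ s, a i ⊗ₜ[k] (c i ⊗ₜ[k] b i) = 0 := by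
  rw [← map_comm_sum, h, map_zero]

lemma sum_leftComm_eq_zero (h : ∑ i ∈ s, a i ⊗ₜ[k] (b i ⊗ₜ[k] c i) = 0) :
    ∑ i ∈ s, b i ⊗ₜ[k] (a i ⊗ₜ[k] c i) = 0 := by
  rw [← leftComm_sum, h, map_zero]

/-- A tensor lying in `S ⊗ T ⊗ C` has rank at most `dim S * dim T`. -/
lemma tRank_sum_le_finrank_mul (S : Submodule k A) (T : Submodule k B)
    [FiniteDimensional k S] [FiniteDimensional k T]
    (ha : ∀ i ∈ s, a i ∈ S) (hb : ∀ i ∈ s, b i ∈ T) :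
    tRank k (∑ i ∈ s, a i ⊗ₜ[k] (b i ⊗ₜ[k] c i)) ≤
      Module.finrank k S * Module.finrank k T := by
  set u := Module.finBasis k S
  set v := Module.finBasis k T
  have key : ∑ i ∈ s, a i ⊗ₜ[k] (b i ⊗ₜ[k] c i) =
      ∑ x : Fin (Module.finrank k S) × Fin (Module.finrank k T), (u x.1 : A) ⊗ₜ[k]
        ((v x.2 : B) ⊗ₜ[k] ∑ i ∈ s.attach,
          (u.repr ⟨a i, ha i i.2⟩ x.1 * v.repr ⟨b i, hb i i.2⟩ x.2) • c i) := by
    simp_rw [tmul_sum]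
    rw [Finset.sum_comm, ← Finset.sum_attach]
    refine Finset.sum_congr rfl fun i _ => ?_
    have h1 : a i = ∑ x, u.repr ⟨a i, ha i i.2⟩ x • (u x : A) := by
      have h := congrArg S.subtype (u.sum_repr ⟨a i, ha i i.2⟩)
      simpa only [map_sum, map_smul, Submodule.subtype_apply] using h.symm
    have h2 : b i = ∑ x, v.repr ⟨b i, hb i i.2⟩ x • (v x : B) := by
      have h := congrArg T.subtype (v.sum_repr ⟨b i, hb i i.2⟩)
      simpa only [map_sum, map_smul, Submodule.subtype_apply] using h.symm
    conv_lhs => rw [h1, h2]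
    simp_rw [sum_tmul, tmul_sum, Fintype.sum_prod_type, smul_tmul, tmul_smul, smul_tmul', smul_tmul,
      tmul_smul, smul_smul]
    simp only [mul_comm]
  rw [key]
  refine (tRank_sum_le_card _ _ _ _).trans ?_
  simp

/-- Vectors with prescribed images on a linearly independent subfamily. -/
lemma LinearIndepOn.exists_linearMap_apply_eq {b : I → B} {K : Set I} (h : LinearIndepOn k b K)
    (w : I → A) : ∃ f : B →ₗ[k] A, ∀ i ∈ K, f (b i) = w i := by
  obtain ⟨f, hf⟩ := ((Module.Basis.span h).constr k fun i : K => w i).exists_extend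
  refine ⟨f, fun i hi => ?_⟩
  have h1 := (Module.Basis.span h).constr_basis k (fun i : K => w i) ⟨i, hi⟩
  rw [← hf] at h1
  have h2 : (Module.Basis.span h ⟨i, hi⟩ : B) = b i :=
    congrArg Subtype.val (Module.Basis.span_apply h ⟨i, hi⟩)
  simpa [h2] using h1

/-- A subfamily forming a basis of the span of the family `b` over `X`. -/
lemma exists_finset_basis_span [Fintype I] [DecidableEq I] (b : I → B) (X : Finset I) :
    ∃ K ⊆ X, LinearIndepOn k b (K : Set I) ∧
      Submodule.span k (b '' K) = Submodule.span k (b '' X) ∧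
      K.card = Module.finrank k (Submodule.span k (b '' X)) := by
  obtain ⟨K, hKX, -, hspan, hind⟩ :=
    exists_linearIndepOn_extension (K := k) (v := b) (linearIndepOn_empty k b)
      (Set.empty_subset (X : Set I))
  lift K to Finset I using Set.toFinite K
  have hs : Submodule.span k (b '' K) = Submodule.span k (b '' X) :=
    le_antisymm (Submodule.span_mono (Set.image_mono hKX)) (Submodule.span_le.2 hspan)
  refine ⟨K, by simpa using hKX, hind, hs, ?_⟩
  rw [← hs, Set.image_eq_range]
  have := finrank_span_eq_card hind
  simpa using this.symm

lemma eq_zero_or_eq_zero_of_tmul_eq_zero {x : A} {y : B} (h : x ⊗ₜ[k] y = 0) :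
    x = 0 ∨ y = 0 := by
  by_contra! hxy
  obtain ⟨f, hf⟩ : ∃ f : A →ₗ[k] k, f x ≠ 0 := by
    by_contra! hf
    exact hxy.1 ((Module.forall_dual_apply_eq_zero_iff k x).1 hf)
  have h1 := congrArg (TensorProduct.lid k B) (congrArg (TensorProduct.map f LinearMap.id) h)
  simp [hf, hxy.2] at h1

end TensorRank
section DirectSum

variable {k : Type*} [Field k] {A' A'' B' B'' C' C'' : Type*}
  [AddCommGroup A'] [Module k A'] [AddCommGroup A''] [Module k A'']
  [AddCommGroup B'] [Module k B'] [AddCommGroup B''] [Module k B'']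
  [AddCommGroup C'] [Module k C'] [AddCommGroup C''] [Module k C'']

open Classical in
/-- Substitution bound: the terms with vanishing `C'`-part, a basis of the span of the `A''`-parts
of the other terms, and a basis of the span of their `B''`-parts can be removed simultaneously. -/
lemma tRank_add_finrank_add_finrank_le_card {I : Type*} [Fintype I]
    (a' : I → A') (a'' : I → A'') (b' : I → B') (b'' : I → B'') (c' : I → C')
    (h211 : ∑ i, a'' i ⊗ₜ[k] (b' i ⊗ₜ[k] c' i) = 0)
    (h121 : ∑ i, a' i ⊗ₜ[k] (b'' i ⊗ₜ[k] c' i) = 0)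
    (h221 : ∑ i, a'' i ⊗ₜ[k] (b'' i ⊗ₜ[k] c' i) = 0)
    (X : Finset I) (memX : ∀ i, i ∈ X ↔ c' i ≠ 0) :
    tRank k (∑ i, a' i ⊗ₜ[k] (b' i ⊗ₜ[k] c' i)) + Xᶜ.card +
      Module.finrank k (Submodule.span k (a'' '' X)) +
      Module.finrank k (Submodule.span k (b'' '' X)) ≤ Fintype.card I := by
  obtain ⟨K, hKX, hKind, -, hKcard⟩ := exists_finset_basis_span (k := k) b'' X
  obtain ⟨J, hJX, hJind, -, hJcard⟩ := exists_finset_basis_span (k := k) a'' (X \ K)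
  have hspan : Submodule.span k (a'' '' X) ≤ Submodule.span k (a'' '' (X \ K : Finset I)) := by
    rw [Submodule.span_le]
    rintro _ ⟨i, hi, rfl⟩
    by_cases hiK : i ∈ K
    swap
    · exact Submodule.subset_span ⟨i, by simpa [hiK] using hi, rfl⟩
    set S := Submodule.span k (a'' '' (X \ K : Finset I)) with hS
    obtain ⟨f, hf⟩ := hKind.exists_linearMap_apply_eq (fun j => if j = i then (1 : k) else 0)
    have h := congrArg (TensorProduct.map S.mkQ
      ((TensorProduct.lid k C').toLinearMap ∘ₗ TensorProduct.map f LinearMap.id)) h221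
    rw [map_sum, map_zero, Finset.sum_eq_single i] at h
    · by_contra hmem
      have h1 : S.mkQ (a'' i) ≠ 0 := by simpa using hmem
      have h2 : f (b'' i) = 1 := by simp [hf i hiK]
      simp only [map_tmul, LinearMap.comp_apply, LinearEquiv.coe_coe, lid_tmul, h2, one_smul,
        LinearMap.id_apply] at h
      rcases eq_zero_or_eq_zero_of_tmul_eq_zero h with h | h
      · exact h1 h
      · exact (memX i).1 hi h
    · intro j _ hji
      by_cases hjX : c' j = 0
      · simp [hjX]
      by_cases hjK : j ∈ K
      · simp [hf j hjK, hji]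
      · have : a'' j ∈ S := Submodule.subset_span ⟨j, by simp [hjK, memX, hjX], rfl⟩
        have : S.mkQ (a'' j) = 0 := by simpa using this
        simp only [map_tmul, this, zero_tmul]
    · simp
  have hspan' : Submodule.span k (a'' '' X) = Submodule.span k (a'' '' (X \ K : Finset I)) :=
    le_antisymm hspan (Submodule.span_mono (Set.image_mono (by simp)))
  obtain ⟨f, hf⟩ := hJind.exists_linearMap_apply_eq fun i => -a' i
  obtain ⟨g, hg⟩ := hKind.exists_linearMap_apply_eq fun i => -b' i
  have hsum : ∑ i, a' i ⊗ₜ[k] (b' i ⊗ₜ[k] c' i) =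
      ∑ i ∈ X \ (J ∪ K), (a' i + f (a'' i)) ⊗ₜ[k] ((b' i + g (b'' i)) ⊗ₜ[k] c' i) := by
    have e1 := congrArg (TensorProduct.map f LinearMap.id) h211
    have e2 := congrArg (TensorProduct.map (LinearMap.id (M := A'))
      (TensorProduct.map g (LinearMap.id (M := C')))) h121
    have e3 := congrArg (TensorProduct.map f
      (TensorProduct.map g (LinearMap.id (M := C')))) h221
    simp only [map_sum, map_tmul, LinearMap.id_apply, map_zero] at e1 e2 e3
    rw [Finset.sum_subset (Finset.subset_univ (X \ (J ∪ K)))]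
    · simp only [add_tmul, tmul_add, Finset.sum_add_distrib, e1, e2, e3, add_zero]
    · intro i _ hi
      by_cases hiX : c' i = 0
      · simp [hiX]
      by_cases hiJ : i ∈ J
      · simp [hf i hiJ]
      by_cases hiK : i ∈ K
      · simp [hg i hiK]
      · simp [memX, hiX, hiJ, hiK] at hi
  have hle := (congrArg (tRank k) hsum).le.trans (tRank_sum_le_card (k := k) _ _ _ _)
  have hJK : Disjoint J K := Finset.disjoint_of_subset_left hJX Finset.sdiff_disjoint
  have hsub : J ∪ K ⊆ X := Finset.union_subset (hJX.trans Finset.sdiff_subset) hKX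
  have c1 := Finset.card_sdiff_add_card_eq_card hsub
  have c2 := Finset.card_union_of_disjoint hJK
  have c3 := Finset.card_add_card_compl X
  rw [hspan', ← hJcard, ← hKcard]
  omega

/-- A family of simple tensors in `(A' × A'') ⊗ ((B' × B'') ⊗ (C' × C''))` whose sum has no
component in the six mixed blocks. -/
structure IsBlockSum (k : Type*) [Field k] {A' A'' B' B'' C' C'' : Type*}
    [AddCommGroup A'] [Module k A'] [AddCommGroup A''] [Module k A'']
    [AddCommGroup B'] [Module k B'] [AddCommGroup B''] [Module k B'']
    [AddCommGroup C'] [Module k C'] [AddCommGroup C''] [Module k C'']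
    {I : Type*} [Fintype I] (a' : I → A') (a'' : I → A'') (b' : I → B') (b'' : I → B'')
    (c' : I → C') (c'' : I → C'') : Prop where
  h112 : ∑ i, a' i ⊗ₜ[k] (b' i ⊗ₜ[k] c'' i) = 0
  h121 : ∑ i, a' i ⊗ₜ[k] (b'' i ⊗ₜ[k] c' i) = 0
  h211 : ∑ i, a'' i ⊗ₜ[k] (b' i ⊗ₜ[k] c' i) = 0
  h122 : ∑ i, a' i ⊗ₜ[k] (b'' i ⊗ₜ[k] c'' i) = 0
  h212 : ∑ i, a'' i ⊗ₜ[k] (b' i ⊗ₜ[k] c'' i) = 0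
  h221 : ∑ i, a'' i ⊗ₜ[k] (b'' i ⊗ₜ[k] c' i) = 0

namespace IsBlockSum

variable {I : Type*} [Fintype I] {a' : I → A'} {a'' : I → A''} {b' : I → B'} {b'' : I → B''}
  {c' : I → C'} {c'' : I → C''}

lemma comm (h : IsBlockSum k a' a'' b' b'' c' c'') : IsBlockSum k a' a'' c' c'' b' b'' where
  h112 := sum_comm_eq_zero _ _ _ _ h.h121
  h121 := sum_comm_eq_zero _ _ _ _ h.h112
  h211 := sum_comm_eq_zero _ _ _ _ h.h211
  h122 := sum_comm_eq_zero _ _ _ _ h.h122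
  h212 := sum_comm_eq_zero _ _ _ _ h.h221
  h221 := sum_comm_eq_zero _ _ _ _ h.h212

lemma leftComm (h : IsBlockSum k a' a'' b' b'' c' c'') : IsBlockSum k b' b'' a' a'' c' c'' where
  h112 := sum_leftComm_eq_zero _ _ _ _ h.h112
  h121 := sum_leftComm_eq_zero _ _ _ _ h.h211
  h211 := sum_leftComm_eq_zero _ _ _ _ h.h121
  h122 := sum_leftComm_eq_zero _ _ _ _ h.h212
  h212 := sum_leftComm_eq_zero _ _ _ _ h.h122
  h221 := sum_leftComm_eq_zero _ _ _ _ h.h221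

end IsBlockSum
open Classical in
/-- If the rank of a direct sum is less than the sum of the ranks, then the rank of the second
summand exceeds each of its multilinear ranks by at least `4`. -/
theorem IsBlockSum.finrank_span_add_four_le {I : Type*} [Fintype I]
    {a' : I → A'} {a'' : I → A''} {b' : I → B'} {b'' : I → B''} {c' : I → C'} {c'' : I → C''}
    (h : IsBlockSum k a' a'' b' b'' c' c'')
    (hlt : Fintype.card I < tRank k (∑ i, a' i ⊗ₜ[k] (b' i ⊗ₜ[k] c' i)) +
      tRank k (∑ i, a'' i ⊗ₜ[k] (b'' i ⊗ₜ[k] c'' i))) :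
    Module.finrank k (Submodule.span k (Set.range a'')) + 4 ≤
      tRank k (∑ i, a'' i ⊗ₜ[k] (b'' i ⊗ₜ[k] c'' i)) := by
  set X : Finset I := Finset.univ.filter fun i => c' i ≠ 0 with hX
  set Y : Finset I := Finset.univ.filter fun i => b' i ≠ 0 with hY
  have memX : ∀ i, i ∈ X ↔ c' i ≠ 0 := by simp [hX]
  have memY : ∀ i, i ∈ Y ↔ b' i ≠ 0 := by simp [hY]
  have hC := tRank_add_finrank_add_finrank_le_card a' a'' b' b'' c' h.h211 h.h121 h.h221 X memX
  have hB := tRank_add_finrank_add_finrank_le_card a' a'' c' c'' b'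
    h.comm.h211 h.comm.h121 h.comm.h221 Y memY
  rw [tRank_sum_comm] at hB
  set R' := tRank k (∑ i, a' i ⊗ₜ[k] (b' i ⊗ₜ[k] c' i))
  set R'' := tRank k (∑ i, a'' i ⊗ₜ[k] (b'' i ⊗ₜ[k] c'' i)) with hR''
  set U := Submodule.span k (a'' '' X)
  set V := Submodule.span k (a'' '' Y)
  set S := Submodule.span k (b'' '' X)
  set T := Submodule.span k (c'' '' Y)
  have fU : FiniteDimensional k U := FiniteDimensional.span_of_finite k (Set.toFinite _)
  have fV : FiniteDimensional k V := FiniteDimensional.span_of_finite k (Set.toFinite _)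
  have fS : FiniteDimensional k S := FiniteDimensional.span_of_finite k (Set.toFinite _)
  have fT : FiniteDimensional k T := FiniteDimensional.span_of_finite k (Set.toFinite _)
  have finrank_range_le : ∀ Z : Finset I, Module.finrank k (Submodule.span k (Set.range a'')) ≤
      Module.finrank k (Submodule.span k (a'' '' Z)) + Zᶜ.card := by
    intro Z
    have fZ : ∀ W : Finset I, FiniteDimensional k (Submodule.span k (a'' '' W)) := fun W =>
      FiniteDimensional.span_of_finite k (Set.toFinite _)
    have hZ : Submodule.span k (Set.range a'') =
        Submodule.span k (a'' '' Z) ⊔ Submodule.span k (a'' '' (Zᶜ : Finset I)) := by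
      rw [← Submodule.span_union, ← Set.image_union, ← Finset.coe_union, Finset.union_compl,
        Finset.coe_univ, Set.image_univ]
    have hZc : Module.finrank k (Submodule.span k (a'' '' (Zᶜ : Finset I))) ≤ Zᶜ.card := by
      rw [← Finset.coe_image]
      exact (finrank_span_finset_le_card _).trans Finset.card_image_le
    rw [hZ]
    exact (Submodule.finrank_add_le_finrank_add_finrank _ _).trans (Nat.add_le_add_left hZc _)
  have hα : Module.finrank k (Submodule.span k (Set.range a'')) ≤
      Module.finrank k U + Xᶜ.card := finrank_range_le X
  have hα' : Module.finrank k (Submodule.span k (Set.range a'')) ≤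
      Module.finrank k V + Yᶜ.card := finrank_range_le Y
  have hδ : Module.finrank k (Submodule.span k (Set.range a'')) ≤
      Module.finrank k (U ⊔ V : Submodule k A'') + (X ∪ Y)ᶜ.card := by
    have := finrank_range_le (X ∪ Y)
    rwa [Finset.coe_union, Set.image_union, Submodule.span_union] at this
  have hUV := Submodule.finrank_sup_add_finrank_inf_eq U V
  -- the terms with nonzero `B'`- and `C'`-parts
  set ρ := tRank k (∑ i ∈ X ∩ Y, a'' i ⊗ₜ[k] (b'' i ⊗ₜ[k] c'' i)) with hρ
  have hR : R'' ≤ (X ∩ Y)ᶜ.card + ρ := by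
    rw [hR'', ← Finset.sum_compl_add_sum (X ∩ Y)]
    exact (tRank_add_le _ _).trans (Nat.add_le_add_right (tRank_sum_le_card _ _ _ _) _)
  have ha : ∀ i ∈ X ∩ Y, a'' i ∈ U ⊓ V := fun i hi =>
    ⟨Submodule.subset_span ⟨i, (Finset.mem_inter.1 hi).1, rfl⟩,
      Submodule.subset_span ⟨i, (Finset.mem_inter.1 hi).2, rfl⟩⟩
  have hb : ∀ i ∈ X ∩ Y, b'' i ∈ S := fun i hi =>
    Submodule.subset_span ⟨i, (Finset.mem_inter.1 hi).1, rfl⟩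
  have hc : ∀ i ∈ X ∩ Y, c'' i ∈ T := fun i hi =>
    Submodule.subset_span ⟨i, (Finset.mem_inter.1 hi).2, rfl⟩
  have fUV : FiniteDimensional k (U ⊓ V : Submodule k A'') :=
    Submodule.finiteDimensional_of_le inf_le_left
  have hab := tRank_sum_le_finrank_mul (X ∩ Y) a'' b'' c'' (U ⊓ V) S ha hb
  have hac := tRank_sum_le_finrank_mul (X ∩ Y) a'' c'' b'' (U ⊓ V) T ha hc
  have hbc := tRank_sum_le_finrank_mul (X ∩ Y) b'' c'' a'' S T hb hc
  rw [tRank_sum_comm] at hac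
  rw [tRank_sum_comm, tRank_sum_leftComm] at hbc
  rw [← hρ] at hab hac hbc
  -- some term has nonzero `B'`-, `B''`-, `C'`- and `C''`-parts
  obtain ⟨i, hi1, hi2, hi3, hi4⟩ : ∃ i, b' i ≠ 0 ∧ c' i ≠ 0 ∧ b'' i ≠ 0 ∧ c'' i ≠ 0 := by
    by_contra! hno
    set Z : Finset I := Finset.univ.filter fun i => b'' i ≠ 0 ∧ c'' i ≠ 0 with hZ
    have h1 : R' ≤ (X ∩ Y).card := by
      refine le_trans (le_of_eq ?_) (tRank_sum_le_card (k := k) (X ∩ Y) a' b' c')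
      refine congrArg (tRank k) (Finset.sum_subset (Finset.subset_univ _) fun i _ hi => ?_).symm
      simp only [Finset.mem_inter, memX, memY, not_and_or, not_not] at hi
      rcases hi with hi | hi <;> simp [hi]
    have h2 : R'' ≤ Z.card := by
      refine le_trans (le_of_eq ?_) (tRank_sum_le_card (k := k) Z a'' b'' c'')
      refine congrArg (tRank k) (Finset.sum_subset (Finset.subset_univ _) fun i _ hi => ?_).symm
      simp only [hZ, Finset.mem_filter, Finset.mem_univ, true_and, not_and_or, not_not] at hi
      rcases hi with hi | hi <;> simp [hi]
    have h3 : Disjoint (X ∩ Y) Z := by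
      rw [Finset.disjoint_left]
      intro i hi hiZ
      simp only [Finset.mem_inter, memX, memY] at hi
      simp only [hZ, Finset.mem_filter, Finset.mem_univ, true_and] at hiZ
      exact hiZ.2 (hno i hi.2 hi.1 hiZ.1)
    have h4 := Finset.card_le_univ ((X ∩ Y) ∪ Z)
    rw [Finset.card_union_of_disjoint h3] at h4
    omega
  have hS : 0 < Module.finrank k S := by
    have : (⟨b'' i, Submodule.subset_span ⟨i, (memX i).2 hi2, rfl⟩⟩ : S) ≠ 0 := by
      simpa using hi3
    have := nontrivial_of_ne _ _ this
    exact Module.finrank_pos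
  have hT : 0 < Module.finrank k T := by
    have : (⟨c'' i, Submodule.subset_span ⟨i, (memY i).2 hi1, rfl⟩⟩ : T) ≠ 0 := by
      simpa using hi4
    have := nontrivial_of_ne _ _ this
    exact Module.finrank_pos
  have c1 : (X ∩ Y)ᶜ.card + (X ∪ Y)ᶜ.card = Xᶜ.card + Yᶜ.card := by
    rw [Finset.compl_inter, Finset.compl_union]
    exact Finset.card_union_add_card_inter _ _
  by_contra! hcon
  have hS2 : Module.finrank k S ≤ 2 := by omega
  have hT2 : Module.finrank k T ≤ 2 := by omega
  generalize Module.finrank k S = e at *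
  generalize Module.finrank k T = f at *
  interval_cases e <;> interval_cases f <;> omega

end DirectSum

section RankSix

open Matrix

variable {K : Type*} [Field K]

/-- A singular `3 × 3` matrix is a sum of two matrices of rank at most one. -/
lemma exists_eq_vecMulVec_add_vecMulVec {N : Matrix (Fin 3) (Fin 3) K} (hN : N.det = 0) :
    ∃ x₁ y₁ x₂ y₂ : Fin 3 → K, N = vecMulVec x₁ y₁ + vecMulVec x₂ y₂ := by
  obtain ⟨v, hv, hNv⟩ := exists_mulVec_eq_zero_iff.2 hN
  obtain ⟨j, hj⟩ := Function.ne_iff.1 hv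
  rw [Pi.zero_apply] at hj
  refine ⟨fun i => N i (j + 1), Pi.single (j + 1) 1 - Pi.single j (v (j + 1) / v j),
    fun i => N i (j + 2), Pi.single (j + 2) 1 - Pi.single j (v (j + 2) / v j), ?_⟩
  ext i l
  have h := congrFun hNv i
  simp only [mulVec, dotProduct, Fin.sum_univ_three, Pi.zero_apply] at h
  fin_cases j <;> fin_cases l <;> simp at hj <;> simp [vecMulVec_apply] <;> field_simp <;>
    linear_combination h

lemma det_one_sub_smul_vecMulVec_eq_zero {x y : Fin 3 → K} (h : y ⬝ᵥ x ≠ 0) :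
    (1 - (y ⬝ᵥ x)⁻¹ • vecMulVec x y).det = 0 := by
  refine exists_mulVec_eq_zero_iff.1 ⟨x, ?_, ?_⟩
  · rintro rfl
    simp at h
  · simp [sub_mulVec, smul_mulVec, vecMulVec_mulVec, smul_smul, h]

lemma exists_eq_smul_of_cross_eq_zero {u v : Fin 3 → K} (hu : u ≠ 0)
    (h : crossProduct u v = 0) : ∃ s : K, s • u = v := by
  by_contra! hs
  exact crossProduct_ne_zero_iff_linearIndependent.2 ((LinearIndependent.pair_iff' hu).2 hs) h

/-- A sum of two rank-one `3 × 3` matrices has rank at most one, or it can be rewritten so that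
the first summand has nonzero trace. -/
lemma exists_vecMulVec_or_dotProduct_ne_zero (x₁ y₁ x₂ y₂ : Fin 3 → K) :
    (∃ x y, vecMulVec x₁ y₁ + vecMulVec x₂ y₂ = vecMulVec x y) ∨
    ∃ u₁ v₁ u₂ v₂, vecMulVec x₁ y₁ + vecMulVec x₂ y₂ = vecMulVec u₁ v₁ + vecMulVec u₂ v₂ ∧
      v₁ ⬝ᵥ u₁ ≠ 0 := by
  by_cases h11 : y₁ ⬝ᵥ x₁ = 0
  swap
  · exact .inr ⟨x₁, y₁, x₂, y₂, rfl, h11⟩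
  by_cases h22 : y₂ ⬝ᵥ x₂ = 0
  swap
  · exact .inr ⟨x₂, y₂, x₁, y₁, add_comm _ _, h22⟩
  by_cases h21 : y₂ ⬝ᵥ x₁ = 0
  swap
  · exact .inr ⟨x₁, y₁ + y₂, x₂ - x₁, y₂, by simp [vecMulVec_add, sub_vecMulVec],
      by simpa [h11] using h21⟩
  by_cases h12 : y₁ ⬝ᵥ x₂ = 0
  swap
  · exact .inr ⟨x₂, y₂ + y₁, x₁ - x₂, y₁, by
      rw [vecMulVec_add, sub_vecMulVec]
      abel,
      by simpa [h22] using h12⟩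
  left
  by_cases hx : x₁ = 0
  · exact ⟨x₂, y₂, by simp [hx]⟩
  by_cases hc : crossProduct x₁ x₂ = 0
  · obtain ⟨s, rfl⟩ := exists_eq_smul_of_cross_eq_zero hx hc
    exact ⟨x₁, y₁ + s • y₂, by simp [vecMulVec_add, smul_vecMulVec, vecMulVec_smul]⟩
  have key : ∀ y, y ⬝ᵥ x₁ = 0 → y ⬝ᵥ x₂ = 0 → ∃ s : K, s • crossProduct x₁ x₂ = y := by
    intro y h1 h2
    refine exists_eq_smul_of_cross_eq_zero hc ?_
    rw [← neg_eq_zero, cross_anticomm, cross_cross_eq_smul_sub_smul', h2,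
      dotProduct_comm, h1, zero_smul, zero_smul, sub_zero]
  obtain ⟨s, hs⟩ := key y₁ h11 h12
  obtain ⟨t, ht⟩ := key y₂ h21 h22
  exact ⟨s • x₁ + t • x₂, crossProduct x₁ x₂, by
    simp [← hs, ← ht, add_vecMulVec, smul_vecMulVec, vecMulVec_smul]⟩

/-- The span of six given matrices of rank at most one. -/
abbrev vecMulVecSpan (u v : Fin 6 → Fin 3 → K) : Submodule K (Matrix (Fin 3) (Fin 3) K) :=
  Submodule.span K (Set.range fun s => vecMulVec (u s) (v s))

lemma vecMulVec_mem_vecMulVecSpan (u v : Fin 6 → Fin 3 → K) (s : Fin 6) :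
    vecMulVec (u s) (v s) ∈ vecMulVecSpan u v :=
  Submodule.subset_span ⟨s, rfl⟩

lemma exists_mem_vecMulVecSpan_of_det_eq_zero {M N P : Matrix (Fin 3) (Fin 3) K}
    (hM : M.det = 0) (hN : N.det = 0) (hP : P.det = 0) :
    ∃ u v, M ∈ vecMulVecSpan u v ∧ N ∈ vecMulVecSpan u v ∧ P ∈ vecMulVecSpan u v := by
  obtain ⟨x₁, y₁, x₂, y₂, rfl⟩ := exists_eq_vecMulVec_add_vecMulVec hM
  obtain ⟨x₃, y₃, x₄, y₄, rfl⟩ := exists_eq_vecMulVec_add_vecMulVec hN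
  obtain ⟨x₅, y₅, x₆, y₆, rfl⟩ := exists_eq_vecMulVec_add_vecMulVec hP
  have h := vecMulVec_mem_vecMulVecSpan ![x₁, x₂, x₃, x₄, x₅, x₆] ![y₁, y₂, y₃, y₄, y₅, y₆]
  exact ⟨_, _, add_mem (h 0) (h 1), add_mem (h 2) (h 3), add_mem (h 4) (h 5)⟩

lemma exists_one_mem_vecMulVecSpan {M N : Matrix (Fin 3) (Fin 3) K}
    (hM : M.det = 0) (hN : N.det = 0) :
    ∃ u v, (1 : Matrix (Fin 3) (Fin 3) K) ∈ vecMulVecSpan u v ∧ M ∈ vecMulVecSpan u v ∧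
      N ∈ vecMulVecSpan u v := by
  obtain ⟨x₁, y₁, x₂, y₂, rfl⟩ := exists_eq_vecMulVec_add_vecMulVec hM
  rcases exists_vecMulVec_or_dotProduct_ne_zero x₁ y₁ x₂ y₂ with
    ⟨x, y, hxy⟩ | ⟨u₁, v₁, u₂, v₂, huv, hne⟩
  · obtain ⟨x₃, y₃, x₄, y₄, rfl⟩ := exists_eq_vecMulVec_add_vecMulVec hN
    have h := vecMulVec_mem_vecMulVecSpan
      ![Pi.single 0 1, Pi.single 1 1, Pi.single 2 1, x, x₃, x₄]
      ![Pi.single 0 1, Pi.single 1 1, Pi.single 2 1, y, y₃, y₄]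
    refine ⟨_, _, ?_, hxy ▸ h 3, add_mem (h 4) (h 5)⟩
    convert add_mem (add_mem (h 0) (h 1)) (h 2)
    ext i j
    fin_cases i <;> fin_cases j <;> simp [vecMulVec_apply]
  · rw [huv]
    obtain ⟨x₃, y₃, x₄, y₄, rfl⟩ := exists_eq_vecMulVec_add_vecMulVec hN
    obtain ⟨x₅, y₅, x₆, y₆, h56⟩ := exists_eq_vecMulVec_add_vecMulVec
      (det_one_sub_smul_vecMulVec_eq_zero hne)
    have h := vecMulVec_mem_vecMulVecSpan ![u₁, u₂, x₃, x₄, x₅, x₆] ![v₁, v₂, y₃, y₄, y₅, y₆]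
    refine ⟨_, _, ?_, add_mem (h 0) (h 1), add_mem (h 2) (h 3)⟩
    rw [sub_eq_iff_eq_add.1 h56]
    exact add_mem (add_mem (h 4) (h 5)) (Submodule.smul_mem _ _ (h 0))

lemma exists_det_sub_smul_one_eq_zero [IsAlgClosed K] (N : Matrix (Fin 3) (Fin 3) K) :
    ∃ μ : K, (N - μ • 1).det = 0 := by
  obtain ⟨μ, hμ⟩ := IsAlgClosed.exists_root N.charpoly (by simp [charpoly_degree_eq_dim])
  refine ⟨μ, ?_⟩
  rw [Polynomial.IsRoot, eval_charpoly, ← neg_sub, det_neg] at hμ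
  simpa [← smul_one_eq_diagonal] using hμ

lemma exists_mem_vecMulVecSpan_of_isUnit_det [IsAlgClosed K] {P : Matrix (Fin 3) (Fin 3) K}
    (hP : IsUnit P.det) (M N : Matrix (Fin 3) (Fin 3) K) :
    ∃ u v, P ∈ vecMulVecSpan u v ∧ M ∈ vecMulVecSpan u v ∧ N ∈ vecMulVecSpan u v := by
  obtain ⟨μ, hμ⟩ := exists_det_sub_smul_one_eq_zero (P⁻¹ * M)
  obtain ⟨ν, hν⟩ := exists_det_sub_smul_one_eq_zero (P⁻¹ * N)
  obtain ⟨u, v, h1, hM, hN⟩ := exists_one_mem_vecMulVecSpan hμ hν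
  have key : ∀ Q ∈ vecMulVecSpan u v, P * Q ∈ vecMulVecSpan (fun s => P *ᵥ u s) v := by
    intro Q hQ
    have h := Submodule.mem_map_of_mem (f := LinearMap.mulLeft K P) hQ
    rw [Submodule.map_span, ← Set.range_comp] at h
    simpa [Function.comp_def, mul_vecMulVec] using h
  have inv : ∀ Q, P * (P⁻¹ * Q) = Q := fun Q => mul_nonsing_inv_cancel_left P Q hP
  refine ⟨_, v, by simpa using key _ h1, ?_, ?_⟩
  · simpa [inv] using key _ (add_mem hM (Submodule.smul_mem _ μ h1))
  · simpa [inv] using key _ (add_mem hN (Submodule.smul_mem _ ν h1))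

/-- Any three `3 × 3` matrices over an algebraically closed field lie in the span of six matrices
of rank at most one. -/
lemma exists_forall_mem_vecMulVecSpan [IsAlgClosed K]
    (M : Fin 3 → Matrix (Fin 3) (Fin 3) K) : ∃ u v, ∀ j, M j ∈ vecMulVecSpan u v := by
  by_cases h : ∀ j, (M j).det = 0
  · obtain ⟨u, v, h0, h1, h2⟩ := exists_mem_vecMulVecSpan_of_det_eq_zero (h 0) (h 1) (h 2)
    exact ⟨u, v, by simp [Fin.forall_fin_succ, h0, h1, h2]⟩
  · push Not at h
    obtain ⟨i, hi⟩ := h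
    obtain ⟨u, v, h0, h1, h2⟩ :=
      exists_mem_vecMulVecSpan_of_isUnit_det (isUnit_iff_ne_zero.2 hi) (M (i + 1)) (M (i + 2))
    refine ⟨u, v, fun j => ?_⟩
    obtain rfl | rfl | rfl : j = i ∨ j = i + 1 ∨ j = i + 2 := by
      clear * -
      revert i j
      decide
    exacts [h0, h1, h2]

/-- The tensor rank in `K³ ⊗ K³ ⊗ K³` is at most `6` if `K` is algebraically closed. -/
lemma tRank_le_six [IsAlgClosed K]
    (p : (Fin 3 → K) ⊗[K] ((Fin 3 → K) ⊗[K] (Fin 3 → K))) : tRank K p ≤ 6 := by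
  obtain ⟨r, x, y, z, rfl⟩ := exists_sum_fin p
  obtain ⟨u, v, h⟩ := exists_forall_mem_vecMulVecSpan
    fun j => ∑ i, x i j • vecMulVec (y i) (z i)
  simp_rw [vecMulVecSpan, Submodule.mem_span_range_iff_exists_fun] at h
  choose w hw using h
  set G : Matrix (Fin 3) (Fin 3) K →ₗ[K] (Fin 3 → K) ⊗[K] (Fin 3 → K) :=
    ∑ l : Fin 3, TensorProduct.mk K _ _ (Pi.single l 1) ∘ₗ LinearMap.proj l with hG
  have sum_single : ∀ t : Fin 3 → K, ∑ l, t l • Pi.single l (1 : K) = t := fun t => by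
    ext l
    simp [Finset.sum_apply, Pi.single_apply]
  have hGmul : ∀ s t : Fin 3 → K, G (vecMulVec s t) = s ⊗ₜ t := fun s t => by
    have hrow : ∀ l, vecMulVec s t l = s l • t := fun l => rfl
    conv_rhs => rw [← sum_single s, sum_tmul]
    simp only [hG, LinearMap.sum_apply, smul_tmul]
    exact Finset.sum_congr rfl fun l _ => congrArg ((Pi.single l 1 : Fin 3 → K) ⊗ₜ[K] ·) (hrow l)
  have expand : ∀ t : Fin 3 → K, ∀ q : (Fin 3 → K) ⊗[K] (Fin 3 → K),
      t ⊗ₜ[K] q = ∑ j, (Pi.single j 1 : Fin 3 → K) ⊗ₜ[K] (t j • q) := fun t q => by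
    conv_lhs => rw [← sum_single t, sum_tmul]
    simp [smul_tmul]
  have heq : ∑ i, x i ⊗ₜ[K] (y i ⊗ₜ[K] z i) =
      ∑ s, (fun j => w j s) ⊗ₜ[K] (u s ⊗ₜ[K] v s) := by
    rw [Finset.sum_congr rfl fun i _ => expand (x i) _,
      Finset.sum_congr rfl fun s _ => expand (fun j => w j s) _, Finset.sum_comm]
    conv_rhs => rw [Finset.sum_comm]
    refine Finset.sum_congr rfl fun j _ => ?_
    rw [← tmul_sum, ← tmul_sum]
    have := congrArg G (hw j)
    simp only [map_sum, map_smul, hGmul] at this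
    rw [this]
  rw [heq]
  exact (tRank_sum_le_card _ _ _ _).trans (by simp)

variable {A B C : Type*} [AddCommGroup A] [Module K A] [AddCommGroup B] [Module K B]
  [AddCommGroup C] [Module K C]

/-- A finite family spanning a space of dimension at most `n` factors through `Kⁿ`. -/
lemma exists_linearMap_fin_apply_eq {I : Type*} [Finite I] {n : ℕ} (a : I → A)
    (h : Module.finrank K (Submodule.span K (Set.range a)) ≤ n) :
    ∃ (f : (Fin n → K) →ₗ[K] A) (x : I → Fin n → K), ∀ i, a i = f (x i) := by
  have : FiniteDimensional K (Submodule.span K (Set.range a)) :=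
    FiniteDimensional.span_of_finite K (Set.finite_range a)
  set S := Submodule.span K (Set.range a)
  set b := Module.finBasis K S
  have hmem : ∀ i, a i ∈ S := fun i => Submodule.subset_span ⟨i, rfl⟩
  refine ⟨Fintype.linearCombination K fun j => if hj : j.1 < Module.finrank K S then
      (b ⟨j, hj⟩ : A) else 0,
    fun i => Function.extend (Fin.castLE h) (b.repr ⟨a i, hmem i⟩) 0, fun i => ?_⟩
  have h1 := congrArg S.subtype (b.sum_repr ⟨a i, hmem i⟩)
  simp only [map_sum, map_smul, Submodule.subtype_apply] at h1
  rw [Fintype.linearCombination_apply, ← h1]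
  refine Finset.sum_of_injOn (Fin.castLE h) (Fin.castLE_injective h).injOn
    (fun _ _ => Finset.mem_coe.2 (Finset.mem_univ _)) (fun j _ hj => ?_) fun j _ => ?_
  · beta_reduce
    rw [Function.extend_apply', Pi.zero_apply, zero_smul]
    rintro ⟨x, hx⟩
    exact hj ⟨x, by simp, hx⟩
  · beta_reduce
    rw [(Fin.castLE_injective h).extend_apply]
    simp

lemma tRank_sum_le_six [IsAlgClosed K] {I : Type*} [Fintype I]
    (a : I → A) (b : I → B) (c : I → C)
    (ha : Module.finrank K (Submodule.span K (Set.range a)) ≤ 3)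
    (hb : Module.finrank K (Submodule.span K (Set.range b)) ≤ 3)
    (hc : Module.finrank K (Submodule.span K (Set.range c)) ≤ 3) :
    tRank K (∑ i, a i ⊗ₜ[K] (b i ⊗ₜ[K] c i)) ≤ 6 := by
  obtain ⟨f, x, hf⟩ := exists_linearMap_fin_apply_eq a ha
  obtain ⟨g, y, hg⟩ := exists_linearMap_fin_apply_eq b hb
  obtain ⟨h, z, hh⟩ := exists_linearMap_fin_apply_eq c hc
  have := (tRank_map_le f g h (∑ i, x i ⊗ₜ[K] (y i ⊗ₜ[K] z i))).trans (tRank_le_six _)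
  simpa [hf, hg, hh] using this

end RankSix

section Additivity

variable {k : Type*} [Field k] {A' A'' B' B'' C' C'' : Type*}
  [AddCommGroup A'] [Module k A'] [AddCommGroup A''] [Module k A'']
  [AddCommGroup B'] [Module k B'] [AddCommGroup B''] [Module k B'']
  [AddCommGroup C'] [Module k C'] [AddCommGroup C''] [Module k C'']
  (p' : A' ⊗[k] (B' ⊗[k] C')) (p'' : A'' ⊗[k] (B'' ⊗[k] C''))

lemma tRank_dsTensor_le : tRank k (dsTensor p' p'') ≤ tRank k p' + tRank k p'' :=
  (tRank_add_le _ _).trans (Nat.add_le_add (tRank_map_le _ _ _ _) (tRank_map_le _ _ _ _))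

lemma map_dsTensor {A B C : Type*} [AddCommGroup A] [Module k A] [AddCommGroup B] [Module k B]
    [AddCommGroup C] [Module k C] (f : A' × A'' →ₗ[k] A) (g : B' × B'' →ₗ[k] B)
    (l : C' × C'' →ₗ[k] C) :
    TensorProduct.map f (TensorProduct.map g l) (dsTensor p' p'') =
      TensorProduct.map (f ∘ₗ LinearMap.inl k A' A'') (TensorProduct.map
        (g ∘ₗ LinearMap.inl k B' B'') (l ∘ₗ LinearMap.inl k C' C'')) p' +
      TensorProduct.map (f ∘ₗ LinearMap.inr k A' A'') (TensorProduct.map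
        (g ∘ₗ LinearMap.inr k B' B'') (l ∘ₗ LinearMap.inr k C' C'')) p'' := by
  rw [dsTensor, map_add]
  simp only [TensorProduct.map_comp, LinearMap.comp_apply]

variable {I : Type*} [Fintype I] {p' p''} {a : I → A' × A''} {b : I → B' × B''} {c : I → C' × C''}

lemma isBlockSum_of_dsTensor_eq (h : dsTensor p' p'' = ∑ i, a i ⊗ₜ[k] (b i ⊗ₜ[k] c i)) :
    IsBlockSum k (fun i => (a i).1) (fun i => (a i).2) (fun i => (b i).1) (fun i => (b i).2)
      (fun i => (c i).1) (fun i => (c i).2) where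
  h112 := by
    have := congrArg (TensorProduct.map (LinearMap.fst k A' A'')
      (TensorProduct.map (LinearMap.fst k B' B'') (LinearMap.snd k C' C''))) h
    simpa [map_dsTensor] using this.symm
  h121 := by
    have := congrArg (TensorProduct.map (LinearMap.fst k A' A'')
      (TensorProduct.map (LinearMap.snd k B' B'') (LinearMap.fst k C' C''))) h
    simpa [map_dsTensor] using this.symm
  h211 := by
    have := congrArg (TensorProduct.map (LinearMap.snd k A' A'')
      (TensorProduct.map (LinearMap.fst k B' B'') (LinearMap.fst k C' C''))) h
    simpa [map_dsTensor] using this.symm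
  h122 := by
    have := congrArg (TensorProduct.map (LinearMap.fst k A' A'')
      (TensorProduct.map (LinearMap.snd k B' B'') (LinearMap.snd k C' C''))) h
    simpa [map_dsTensor] using this.symm
  h212 := by
    have := congrArg (TensorProduct.map (LinearMap.snd k A' A'')
      (TensorProduct.map (LinearMap.fst k B' B'') (LinearMap.snd k C' C''))) h
    simpa [map_dsTensor] using this.symm
  h221 := by
    have := congrArg (TensorProduct.map (LinearMap.snd k A' A'')
      (TensorProduct.map (LinearMap.snd k B' B'') (LinearMap.fst k C' C''))) h
    simpa [map_dsTensor] using this.symm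

lemma sum_fst_of_dsTensor_eq (h : dsTensor p' p'' = ∑ i, a i ⊗ₜ[k] (b i ⊗ₜ[k] c i)) :
    ∑ i, (a i).1 ⊗ₜ[k] ((b i).1 ⊗ₜ[k] (c i).1) = p' := by
  have := congrArg (TensorProduct.map (LinearMap.fst k A' A'')
    (TensorProduct.map (LinearMap.fst k B' B'') (LinearMap.fst k C' C''))) h
  simpa [map_dsTensor] using this.symm

lemma sum_snd_of_dsTensor_eq (h : dsTensor p' p'' = ∑ i, a i ⊗ₜ[k] (b i ⊗ₜ[k] c i)) :
    ∑ i, (a i).2 ⊗ₜ[k] ((b i).2 ⊗ₜ[k] (c i).2) = p'' := by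
  have := congrArg (TensorProduct.map (LinearMap.snd k A' A'')
    (TensorProduct.map (LinearMap.snd k B' B'') (LinearMap.snd k C' C''))) h
  simpa [map_dsTensor] using this.symm

/-- A sum of simple tensors equal to a direct sum whose second summand has rank at most `7` has at
least as many terms as the sum of the ranks of the summands. -/
lemma tRank_add_tRank_le_card_of_dsTensor_eq [IsAlgClosed k]
    (h : dsTensor p' p'' = ∑ i, a i ⊗ₜ[k] (b i ⊗ₜ[k] c i)) (hp'' : tRank k p'' ≤ 7) :
    tRank k p' + tRank k p'' ≤ Fintype.card I := by
  by_contra! hlt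
  have hs'' := sum_snd_of_dsTensor_eq h
  have hlt' := hlt
  rw [← sum_fst_of_dsTensor_eq h, ← hs''] at hlt'
  have hblk := isBlockSum_of_dsTensor_eq h
  have hA := hblk.finrank_span_add_four_le hlt'
  have hB := hblk.leftComm.finrank_span_add_four_le (by
    rwa [tRank_sum_leftComm, tRank_sum_leftComm _ fun i => (a i).2])
  have hC := hblk.comm.leftComm.finrank_span_add_four_le (by
    rwa [tRank_sum_leftComm, tRank_sum_leftComm _ fun i => (a i).2, tRank_sum_comm,
      tRank_sum_comm _ fun i => (a i).2])
  rw [tRank_sum_leftComm] at hB hC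
  rw [tRank_sum_comm] at hC
  have : FiniteDimensional k (Submodule.span k (Set.range fun i => (a i).2)) :=
    FiniteDimensional.span_of_finite k (Set.finite_range _)
  have : FiniteDimensional k (Submodule.span k (Set.range fun i => (b i).2)) :=
    FiniteDimensional.span_of_finite k (Set.finite_range _)
  have hmul := tRank_sum_le_finrank_mul (k := k) Finset.univ (fun i => (a i).2) (fun i => (b i).2)
    (fun i => (c i).2) (Submodule.span k (Set.range fun i => (a i).2))
    (Submodule.span k (Set.range fun i => (b i).2))
    (fun i _ => Submodule.subset_span ⟨i, rfl⟩) (fun i _ => Submodule.subset_span ⟨i, rfl⟩)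
  rw [hs''] at hA hB hC hmul
  have h6 := tRank_sum_le_six (K := k) (fun i => (a i).2) (fun i => (b i).2) (fun i => (c i).2)
    (by omega) (by omega) (by omega)
  rw [hs''] at h6
  have hsq := hmul.trans (Nat.mul_le_mul (Nat.le_sub_of_add_le hA) (Nat.le_sub_of_add_le hB))
  have h4 : 4 ≤ tRank k p'' := (Nat.le_add_left _ _).trans hA
  clear hA hB hC hmul hlt hlt'
  generalize tRank k p'' = r at *
  interval_cases r <;> omega

/-- Rank is additive on direct sums if one summand has rank at most `7`. -/
theorem tRank_dsTensor_of_le_seven [IsAlgClosed k] (hp'' : tRank k p'' ≤ 7) :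
    tRank k (dsTensor p' p'') = tRank k p' + tRank k p'' := by
  obtain ⟨a, b, c, h⟩ := exists_sum_tRank (dsTensor p' p'')
  exact le_antisymm (tRank_dsTensor_le p' p'')
    ((tRank_add_tRank_le_card_of_dsTensor_eq h hp'').trans_eq (Fintype.card_fin _))

end Additivity

/-- Over `ℂ`, if both tensors have rank at most 7, then the rank of their direct sum is
additive. -/
theorem tRank_additive_of_rank_le_seven {A' A'' B' B'' C' C'' : Type*}
    [AddCommGroup A'] [Module ℂ A'] [FiniteDimensional ℂ A']
    [AddCommGroup A''] [Module ℂ A''] [FiniteDimensional ℂ A'']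
    [AddCommGroup B'] [Module ℂ B'] [FiniteDimensional ℂ B']
    [AddCommGroup B''] [Module ℂ B''] [FiniteDimensional ℂ B'']
    [AddCommGroup C'] [Module ℂ C'] [FiniteDimensional ℂ C']
    [AddCommGroup C''] [Module ℂ C''] [FiniteDimensional ℂ C'']
    (p' : A' ⊗[ℂ] (B' ⊗[ℂ] C')) (p'' : A'' ⊗[ℂ] (B'' ⊗[ℂ] C''))
    (hp' : tRank ℂ p' ≤ 7) (hp'' : tRank ℂ p'' ≤ 7) :
    tRank ℂ (dsTensor p' p'') = tRank ℂ p' + tRank ℂ p'' := by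
  exact tRank_dsTensor_of_le_seven hp''
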